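/- Let H be a quasi-Hopf algebra over a field k with bijective antipode S (inverse S̄), μ : H → k an algebra map, f the Drinfeld twist, and set U^R = S̄(q^L_2 f̄2) ⊗ S̄(q^L_1 f̄1), V^R = S(p^L_2)f1 ⊗ S(p^L_1)f2, and W^R = μ(φ3)·S̄((μ ⇀ q^L_2)φ2 f̄2) ⊗ S̄(q^L_1 φ1 f̄1), where μ ⇀ h = μ(h_(2))h_(1). Then for λ ∈ H* the following are equivalent: (i) ⟨λ, V^R_1 h_(1) U^R_1⟩ · V^R_2 h_(2) U^R_2 = φ1·⟨λ, hS̄(φ2)⟩·μ(φ3) for all h ∈ H; (ii) ⟨λ, V^R_1 h_(1) W^R_1⟩ · V^R_2 h_(2) W^R_2 = λ(h)·1 for all h ∈ H. -/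

import Mathlib

open scoped TensorProduct

noncomputable section

/-- A quasi-Hopf algebra over a field `k`, presented together with explicit
(Sweedler-style) finite representations of the comultiplication and of the
associator `φ` and its inverse `φ⁻¹`.  The fields `n, d1, d2` give, for every
`h : H`, a finite family with `Δ h = ∑ i < n h, d1 h i ⊗ d2 h i`; similarly
`P1, P2, P3` (resp. `Q1, Q2, Q3`) are the components of `φ` (resp. `φ⁻¹`). -/
structure QuasiHopf (k H : Type) [Field k] [Ring H] [Algebra k H] where
  comul : H →ₐ[k] H ⊗[k] H
  counit : H →ₐ[k] k
  n : H → ℕ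
  d1 : H → ℕ → H
  d2 : H → ℕ → H
  comul_eq : ∀ h, comul h = ∑ i ∈ Finset.range (n h), d1 h i ⊗ₜ[k] d2 h i
  np : ℕ
  P1 : ℕ → H
  P2 : ℕ → H
  P3 : ℕ → H
  nq : ℕ
  Q1 : ℕ → H
  Q2 : ℕ → H
  Q3 : ℕ → H
  S : H →ₗ[k] H
  Sinv : H →ₗ[k] H
  alpha : H
  beta : H
  S_one : S 1 = 1
  S_mul : ∀ x y : H, S (x * y) = S y * S x
  Sinv_S : ∀ x : H, Sinv (S x) = x
  S_Sinv : ∀ x : H, S (Sinv x) = x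
  phi_phiInv :
    (∑ a ∈ Finset.range np, P1 a ⊗ₜ[k] (P2 a ⊗ₜ[k] P3 a)) *
      (∑ b ∈ Finset.range nq, Q1 b ⊗ₜ[k] (Q2 b ⊗ₜ[k] Q3 b)) = 1
  phiInv_phi :
    (∑ b ∈ Finset.range nq, Q1 b ⊗ₜ[k] (Q2 b ⊗ₜ[k] Q3 b)) *
      (∑ a ∈ Finset.range np, P1 a ⊗ₜ[k] (P2 a ⊗ₜ[k] P3 a)) = 1
  qcoassoc : ∀ h : H,
    ∑ i ∈ Finset.range (n h), d1 h i ⊗ₜ[k] comul (d2 h i) =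
      (∑ a ∈ Finset.range np, P1 a ⊗ₜ[k] (P2 a ⊗ₜ[k] P3 a)) *
        (∑ i ∈ Finset.range (n h), ∑ j ∈ Finset.range (n (d1 h i)),
          d1 (d1 h i) j ⊗ₜ[k] (d2 (d1 h i) j ⊗ₜ[k] d2 h i)) *
        (∑ b ∈ Finset.range nq, Q1 b ⊗ₜ[k] (Q2 b ⊗ₜ[k] Q3 b))
  counit_left : ∀ h : H, ∑ i ∈ Finset.range (n h), counit (d1 h i) • d2 h i = h
  counit_right : ∀ h : H, ∑ i ∈ Finset.range (n h), counit (d2 h i) • d1 h i = h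
  pentagon :
    (∑ a ∈ Finset.range np, P1 a ⊗ₜ[k] (P2 a ⊗ₜ[k] comul (P3 a))) *
      (∑ a ∈ Finset.range np, ∑ i ∈ Finset.range (n (P1 a)),
        d1 (P1 a) i ⊗ₜ[k] (d2 (P1 a) i ⊗ₜ[k] (P2 a ⊗ₜ[k] P3 a))) =
    ((1 : H) ⊗ₜ[k] (∑ a ∈ Finset.range np, P1 a ⊗ₜ[k] (P2 a ⊗ₜ[k] P3 a))) *
      (∑ a ∈ Finset.range np, ∑ i ∈ Finset.range (n (P2 a)),
        P1 a ⊗ₜ[k] (d1 (P2 a) i ⊗ₜ[k] (d2 (P2 a) i ⊗ₜ[k] P3 a))) *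
      (∑ a ∈ Finset.range np, P1 a ⊗ₜ[k] (P2 a ⊗ₜ[k] (P3 a ⊗ₜ[k] (1 : H))))
  counit_mid_phi :
    ∑ a ∈ Finset.range np, counit (P2 a) • (P1 a ⊗ₜ[k] P3 a) = (1 : H) ⊗ₜ[k] (1 : H)
  antipode_alpha : ∀ h : H,
    ∑ i ∈ Finset.range (n h), S (d1 h i) * alpha * d2 h i = counit h • alpha
  antipode_beta : ∀ h : H,
    ∑ i ∈ Finset.range (n h), d1 h i * beta * S (d2 h i) = counit h • beta
  nondeg_1 : ∑ a ∈ Finset.range np, P1 a * beta * S (P2 a) * alpha * P3 a = 1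
  nondeg_2 : ∑ b ∈ Finset.range nq, S (Q1 b) * alpha * Q2 b * beta * S (Q3 b) = 1
  counit_alpha : counit alpha = 1
  counit_beta : counit beta = 1

namespace QuasiHopf

variable {k H : Type} [Field k] [Ring H] [Algebra k H] (q : QuasiHopf k H)

/-- The associator `φ` as an element of `H ⊗ H ⊗ H`. -/
def Phi : H ⊗[k] (H ⊗[k] H) :=
  ∑ a ∈ Finset.range q.np, q.P1 a ⊗ₜ[k] (q.P2 a ⊗ₜ[k] q.P3 a)

/-- `φ⁻¹` as an element of `H ⊗ H ⊗ H`. -/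
def PhiInv : H ⊗[k] (H ⊗[k] H) :=
  ∑ b ∈ Finset.range q.nq, q.Q1 b ⊗ₜ[k] (q.Q2 b ⊗ₜ[k] q.Q3 b)

/-- first components of `p^R = φ̄1 ⊗ φ̄2 β S(φ̄3)` -/
def pR1 (b : ℕ) : H := q.Q1 b

def pR2 (b : ℕ) : H := q.Q2 b * q.beta * q.S (q.Q3 b)

def pRE : H ⊗[k] H := ∑ b ∈ Finset.range q.nq, q.pR1 b ⊗ₜ[k] q.pR2 b

/-- components of `q^R = φ1 ⊗ S̄(α φ3) φ2` -/
def qR1 (a : ℕ) : H := q.P1 a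

def qR2 (a : ℕ) : H := q.Sinv (q.alpha * q.P3 a) * q.P2 a

def qRE : H ⊗[k] H := ∑ a ∈ Finset.range q.np, q.qR1 a ⊗ₜ[k] q.qR2 a

/-- components of `p^L = φ2 S̄(φ1 β) ⊗ φ3` -/
def pL1 (a : ℕ) : H := q.P2 a * q.Sinv (q.P1 a * q.beta)

def pL2 (a : ℕ) : H := q.P3 a

def pLE : H ⊗[k] H := ∑ a ∈ Finset.range q.np, q.pL1 a ⊗ₜ[k] q.pL2 a

/-- components of `q^L = S(φ̄1) α φ̄2 ⊗ φ̄3` -/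
def qL1 (b : ℕ) : H := q.S (q.Q1 b) * q.alpha * q.Q2 b

def qL2 (b : ℕ) : H := q.Q3 b

def qLE : H ⊗[k] H := ∑ b ∈ Finset.range q.nq, q.qL1 b ⊗ₜ[k] q.qL2 b

/-- `𝕒 = S(φ̄1 φ2) α φ̄2 φ3₍₁₎ ⊗ S(φ1) α φ̄3 φ3₍₂₎` -/
def aEl : H ⊗[k] H :=
  ∑ a ∈ Finset.range q.np, ∑ b ∈ Finset.range q.nq, ∑ m ∈ Finset.range (q.n (q.P3 a)),
    (q.S (q.Q1 b * q.P2 a) * q.alpha * q.Q2 b * q.d1 (q.P3 a) m) ⊗ₜ[k]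
      (q.S (q.P1 a) * q.alpha * q.Q3 b * q.d2 (q.P3 a) m)

/-- `𝕓 = φ1₍₁₎ φ̄1 β S(φ3) ⊗ φ1₍₂₎ φ̄2 β S(φ2 φ̄3)` -/
def bEl : H ⊗[k] H :=
  ∑ a ∈ Finset.range q.np, ∑ b ∈ Finset.range q.nq, ∑ m ∈ Finset.range (q.n (q.P1 a)),
    (q.d1 (q.P1 a) m * q.Q1 b * q.beta * q.S (q.P3 a)) ⊗ₜ[k]
      (q.d2 (q.P1 a) m * q.Q2 b * q.beta * q.S (q.P2 a * q.Q3 b))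

/-- `(S ⊗ S)(Δ^cop x) = S(x₍₂₎) ⊗ S(x₍₁₎)` -/
def scop (x : H) : H ⊗[k] H :=
  ∑ m ∈ Finset.range (q.n x), q.S (q.d2 x m) ⊗ₜ[k] q.S (q.d1 x m)

/-- The Drinfeld twist `f = (S⊗S)(Δ^cop(p^R_1)) · 𝕒 · Δ(p^R_2)`. -/
def twist : H ⊗[k] H :=
  ∑ b ∈ Finset.range q.nq, q.scop (q.pR1 b) * q.aEl * q.comul (q.pR2 b)

/-- `f⁻¹ = Δ(q^L_1) · 𝕓 · (S⊗S)(Δ^cop(q^L_2))`. -/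
def twistInv : H ⊗[k] H :=
  ∑ b ∈ Finset.range q.nq, q.comul (q.qL1 b) * q.bEl * q.scop (q.qL2 b)

/-- `x ⊗ y ↦ S y ⊗ S x` -/
def sswap : H ⊗[k] H →ₗ[k] H ⊗[k] H :=
  (TensorProduct.map q.S q.S).comp (TensorProduct.comm k H H).toLinearMap

/-- `x ⊗ y ↦ S̄ y ⊗ S̄ x` -/
def sswapInv : H ⊗[k] H →ₗ[k] H ⊗[k] H :=
  (TensorProduct.map q.Sinv q.Sinv).comp (TensorProduct.comm k H H).toLinearMap

/-- `U^L = f̄1 S(q^R_2) ⊗ f̄2 S(q^R_1)` -/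
def UL : H ⊗[k] H := q.twistInv * q.sswap q.qRE

/-- `V^L = S̄(f2 p^R_2) ⊗ S̄(f1 p^R_1)` -/
def VL : H ⊗[k] H := q.sswapInv (q.twist * q.pRE)

/-- `U^R = S̄(q^L_2 f̄2) ⊗ S̄(q^L_1 f̄1)` -/
def UR : H ⊗[k] H := q.sswapInv (q.qLE * q.twistInv)

/-- `V^R = S(p^L_2) f1 ⊗ S(p^L_1) f2` -/
def VR : H ⊗[k] H := q.sswap q.pLE * q.twist

/-- `h ↦ h ↼ μ = μ(h₍₁₎) h₍₂₎` -/
def lhook (mu : H →ₐ[k] k) : H →ₗ[k] H :=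
  (TensorProduct.lid k H).toLinearMap.comp
    ((TensorProduct.map mu.toLinearMap LinearMap.id).comp q.comul.toLinearMap)

/-- `h ↦ μ ⇀ h = μ(h₍₂₎) h₍₁₎` -/
def rhook (mu : H →ₐ[k] k) : H →ₗ[k] H :=
  (TensorProduct.rid k H).toLinearMap.comp
    ((TensorProduct.map LinearMap.id mu.toLinearMap).comp q.comul.toLinearMap)

/-- `W^L = μ(φ̄1) f̄1 S(q^R_2 φ̄3) ⊗ f̄2 S((q^R_1 ↼ μ) φ̄2)` -/
def WL (mu : H →ₐ[k] k) : H ⊗[k] H :=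
  q.twistInv * q.sswap ((TensorProduct.map (q.lhook mu) LinearMap.id q.qRE) *
    (∑ b ∈ Finset.range q.nq, mu (q.Q1 b) • (q.Q2 b ⊗ₜ[k] q.Q3 b)))

/-- `W^R = μ(φ3) S̄((μ ⇀ q^L_2) φ2 f̄2) ⊗ S̄(q^L_1 φ1 f̄1)` -/
def WR (mu : H →ₐ[k] k) : H ⊗[k] H :=
  q.sswapInv ((TensorProduct.map LinearMap.id (q.rhook mu) q.qLE) *
    (∑ a ∈ Finset.range q.np, mu (q.P3 a) • (q.P1 a ⊗ₜ[k] q.P2 a)) * q.twistInv)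

section Modules

variable {V W X : Type} [AddCommGroup V] [Module k V] [AddCommGroup W] [Module k W]
  [AddCommGroup X] [Module k X]

/-- The tensor-product action `h · (v ⊗ w) = h₍₁₎ v ⊗ h₍₂₎ w`. -/
def tensAct (ρV : H → Module.End k V) (ρW : H → Module.End k W) (h : H) :
    Module.End k (V ⊗[k] W) :=
  ∑ i ∈ Finset.range (q.n h), TensorProduct.map (ρV (q.d1 h i)) (ρW (q.d2 h i))

/-- The action on the left dual: `(h · ξ)(x) = ξ(S(h) x)`. -/
def dualAct (ρX : H → Module.End k X) (h : H) : Module.End k (Module.Dual k X) :=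
  LinearMap.dualMap (ρX (q.S h))

end Modules

end QuasiHopf

/-- `f` intertwines the two given `H`-actions. -/
def IsHLin {k H V W : Type} [Field k] [Ring H] [Algebra k H]
    [AddCommGroup V] [Module k V] [AddCommGroup W] [Module k W]
    (ρV : H → Module.End k V) (ρW : H → Module.End k W) (f : V →ₗ[k] W) : Prop :=
  ∀ (h : H) (v : V), f (ρV h v) = ρW h (f v)

/-- `x ⊗ y ↦ λ(y) • x` -/
def hitR {k H : Type} [Field k] [Ring H] [Algebra k H] (lam : H →ₗ[k] k) :
    H ⊗[k] H →ₗ[k] H :=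
  (TensorProduct.rid k H).toLinearMap.comp (TensorProduct.map LinearMap.id lam)

/-- `x ⊗ y ↦ λ(x) • y` -/
def hitL {k H : Type} [Field k] [Ring H] [Algebra k H] (lam : H →ₗ[k] k) :
    H ⊗[k] H →ₗ[k] H :=
  (TensorProduct.lid k H).toLinearMap.comp (TensorProduct.map lam LinearMap.id)


namespace QuasiHopf

section Helpers

-- needed to find the ring structure on fourfold tensor products
set_option maxSynthPendingDepth 6

variable {k H : Type} [Field k] [Ring H] [Algebra k H] (q : QuasiHopf k H)
variable (B : Type) [Ring B] [Algebra k B]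

/-- `x ⊗ b ↦ x₍₁₎ ⊗ x₍₂₎ ⊗ b` -/
def comulFirst : H ⊗[k] B →ₐ[k] H ⊗[k] (H ⊗[k] B) :=
  (Algebra.TensorProduct.assoc k k k H H B).toAlgHom.comp
    (Algebra.TensorProduct.map q.comul (AlgHom.id k B))

/-- `x ⊗ y ↦ x ⊗ y₍₁₎ ⊗ y₍₂₎` -/
def comulLast : H ⊗[k] H →ₐ[k] H ⊗[k] (H ⊗[k] H) :=
  Algebra.TensorProduct.map (AlgHom.id k H) q.comul

/-- `x ⊗ y ⊗ z ↦ x ⊗ y₍₁₎ ⊗ y₍₂₎ ⊗ z` -/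
def comulMid : H ⊗[k] (H ⊗[k] H) →ₐ[k] H ⊗[k] (H ⊗[k] (H ⊗[k] H)) :=
  Algebra.TensorProduct.map (AlgHom.id k H) (q.comulFirst H)

/-- `x ⊗ y ⊗ z ↦ x ⊗ y ⊗ z₍₁₎ ⊗ z₍₂₎` -/
def comulThird : H ⊗[k] (H ⊗[k] H) →ₐ[k] H ⊗[k] (H ⊗[k] (H ⊗[k] H)) :=
  Algebra.TensorProduct.map (AlgHom.id k H) q.comulLast

/-- `x ⊗ y ⊗ z ↦ x ⊗ y ⊗ z ⊗ 1` -/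
def padRight : H ⊗[k] (H ⊗[k] H) →ₐ[k] H ⊗[k] (H ⊗[k] (H ⊗[k] H)) :=
  Algebra.TensorProduct.map (AlgHom.id k H)
    (Algebra.TensorProduct.map (AlgHom.id k H) Algebra.TensorProduct.includeLeft)

/-- `x ⊗ y ⊗ z ↦ 1 ⊗ x ⊗ y ⊗ z` -/
def padLeft : H ⊗[k] (H ⊗[k] H) →ₐ[k] H ⊗[k] (H ⊗[k] (H ⊗[k] H)) :=
  Algebra.TensorProduct.includeRight

/-- `x ⊗ b ↦ ε(x) b` -/
def counitFirst : H ⊗[k] B →ₐ[k] B :=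
  (Algebra.TensorProduct.lid k B).toAlgHom.comp
    (Algebra.TensorProduct.map q.counit (AlgHom.id k B))

/-- `x ⊗ y ⊗ b ↦ S(x) α y ⊗ b` -/
def contractAlpha : H ⊗[k] (H ⊗[k] B) →ₗ[k] H ⊗[k] B :=
  (TensorProduct.map
    (TensorProduct.lift ((LinearMap.mul k H).comp
      ((LinearMap.mulRight k q.alpha).comp q.S))) LinearMap.id).comp
    (TensorProduct.assoc k H H B).symm.toLinearMap

/-- `a ⊗ b ⊗ c ⊗ d ↦ a β S(d) ⊗ b β S(c)` -/
def contractBeta : H ⊗[k] (H ⊗[k] (H ⊗[k] H)) →ₗ[k] H ⊗[k] H :=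
  (TensorProduct.map
    (TensorProduct.lift (((LinearMap.mul k H).compl₂ q.S).comp (LinearMap.mulRight k q.beta)))
    (TensorProduct.lift (((LinearMap.mul k H).compl₂ q.S).comp (LinearMap.mulRight k q.beta)))).comp
    ((TensorProduct.tensorTensorTensorComm k H H H H).toLinearMap.comp
      ((LinearMap.lTensor (H ⊗[k] H) (TensorProduct.comm k H H).toLinearMap).comp
        (TensorProduct.assoc k H H (H ⊗[k] H)).symm.toLinearMap))

/-- `x ⊗ y ↦ Δ(x) · 𝕓 · (S ⊗ S)(Δ^cop y)` -/
def twistInvMap : H ⊗[k] H →ₗ[k] H ⊗[k] H :=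
  TensorProduct.lift (((LinearMap.mul k (H ⊗[k] H)).compl₂
    (q.sswap.comp q.comul.toLinearMap)).comp
      ((LinearMap.mulRight k q.bEl).comp q.comul.toLinearMap))

variable {B}

@[simp] lemma comulFirst_tmul (x : H) (b : B) :
    q.comulFirst B (x ⊗ₜ b) = TensorProduct.assoc k H H B (q.comul x ⊗ₜ b) := rfl

@[simp] lemma comulLast_tmul (x y : H) : q.comulLast (x ⊗ₜ y) = x ⊗ₜ q.comul y := rfl

@[simp] lemma comulMid_tmul (x : H) (y : H ⊗[k] H) :
    q.comulMid (x ⊗ₜ y) = x ⊗ₜ q.comulFirst H y := rfl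

@[simp] lemma comulThird_tmul (x : H) (y : H ⊗[k] H) :
    q.comulThird (x ⊗ₜ y) = x ⊗ₜ q.comulLast y := rfl

@[simp] lemma padRight_tmul (x y z : H) :
    padRight (k := k) (x ⊗ₜ (y ⊗ₜ z)) = x ⊗ₜ (y ⊗ₜ (z ⊗ₜ 1)) := rfl

@[simp] lemma padLeft_apply (x : H ⊗[k] (H ⊗[k] H)) : padLeft x = 1 ⊗ₜ x := rfl

@[simp] lemma counitFirst_tmul (x : H) (b : B) :
    q.counitFirst B (x ⊗ₜ b) = q.counit x • b := rfl

@[simp] lemma contractAlpha_tmul (x y : H) (b : B) :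
    q.contractAlpha B (x ⊗ₜ (y ⊗ₜ b)) = (q.S x * q.alpha * y) ⊗ₜ b := rfl

@[simp] lemma contractBeta_tmul (a b c d : H) :
    q.contractBeta (a ⊗ₜ (b ⊗ₜ (c ⊗ₜ d))) =
      (a * q.beta * q.S d) ⊗ₜ (b * q.beta * q.S c) := rfl

@[simp] lemma twistInvMap_tmul (x y : H) :
    q.twistInvMap (x ⊗ₜ y) = q.comul x * q.bEl * q.sswap (q.comul y) := rfl

@[simp] lemma sswap_tmul (x y : H) : q.sswap (x ⊗ₜ y) = q.S y ⊗ₜ q.S x := rfl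

@[simp] lemma sswapInv_tmul (x y : H) : q.sswapInv (x ⊗ₜ y) = q.Sinv y ⊗ₜ q.Sinv x := rfl

lemma Sinv_mul (x y : H) : q.Sinv (x * y) = q.Sinv y * q.Sinv x := by
  rw [← q.Sinv_S (q.Sinv y * q.Sinv x), q.S_mul, q.S_Sinv, q.S_Sinv]

lemma Sinv_one : q.Sinv 1 = 1 := by
  conv_lhs => rw [← q.S_one, q.Sinv_S]

lemma sswap_mul (x y : H ⊗[k] H) : q.sswap (x * y) = q.sswap y * q.sswap x := by
  induction x with
  | zero => simp
  | add x₁ x₂ h₁ h₂ => simp only [add_mul, mul_add, map_add, h₁, h₂]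
  | tmul a b =>
    induction y with
    | zero => simp
    | add x₁ x₂ h₁ h₂ => simp only [add_mul, mul_add, map_add, h₁, h₂]
    | tmul c d => simp [q.S_mul]

lemma sswapInv_mul (x y : H ⊗[k] H) : q.sswapInv (x * y) = q.sswapInv y * q.sswapInv x := by
  induction x with
  | zero => simp
  | add x₁ x₂ h₁ h₂ => simp only [add_mul, mul_add, map_add, h₁, h₂]
  | tmul a b =>
    induction y with
    | zero => simp
    | add x₁ x₂ h₁ h₂ => simp only [add_mul, mul_add, map_add, h₁, h₂]
    | tmul c d => simp [q.Sinv_mul]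

lemma sswapInv_sswap (x : H ⊗[k] H) : q.sswapInv (q.sswap x) = x := by
  induction x with
  | zero => simp
  | add x₁ x₂ h₁ h₂ => simp only [map_add, h₁, h₂]
  | tmul a b => simp [q.Sinv_S]

lemma sswap_comul (x : H) : q.sswap (q.comul x) = q.scop x := by
  simp [scop, q.comul_eq x]

lemma Phi_mul_PhiInv : q.Phi * q.PhiInv = 1 := q.phi_phiInv

lemma PhiInv_mul_Phi : q.PhiInv * q.Phi = 1 := q.phiInv_phi

lemma comulLast_comul_mul_Phi (h : H) :
    q.comulLast (q.comul h) * q.Phi = q.Phi * q.comulFirst H (q.comul h) := by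
  have key : q.comulLast (q.comul h) =
      q.Phi * q.comulFirst H (q.comul h) * q.PhiInv := by
    have := q.qcoassoc h
    rw [q.comul_eq h]
    simp only [map_sum, comulLast_tmul, comulFirst_tmul]
    rw [this]
    simp only [Phi, PhiInv, q.comul_eq (q.d1 h _), TensorProduct.sum_tmul, map_sum,
      TensorProduct.assoc_tmul]
  rw [key, mul_assoc, q.PhiInv_mul_Phi, mul_one]

lemma PhiInv_mul_comulLast_comul (h : H) :
    q.PhiInv * q.comulLast (q.comul h) = q.comulFirst H (q.comul h) * q.PhiInv := by
  calc _ = q.PhiInv * (q.comulLast (q.comul h) * q.Phi) * q.PhiInv := by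
        rw [← mul_assoc, mul_assoc _ q.Phi, q.Phi_mul_PhiInv, mul_one]
    _ = _ := by rw [q.comulLast_comul_mul_Phi, ← mul_assoc, q.PhiInv_mul_Phi, one_mul]

lemma pentagon_Phi : q.comulThird q.Phi * q.comulFirst (H ⊗[k] H) q.Phi =
    padLeft q.Phi * q.comulMid q.Phi * padRight q.Phi := by
  have := q.pentagon
  simp only [Phi, padLeft_apply, map_sum, comulThird_tmul, comulLast_tmul, comulFirst_tmul,
    comulMid_tmul, padRight_tmul, q.comul_eq (q.P1 _), q.comul_eq (q.P2 _),
    TensorProduct.sum_tmul, TensorProduct.tmul_sum, TensorProduct.assoc_tmul] at this ⊢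
  exact this

lemma map_mul_eq_one_of_mul_eq_one {A C : Type} [Ring A] [Algebra k A] [Ring C] [Algebra k C]
    (g : A →ₐ[k] C) {x y : A} (h : x * y = 1) : g x * g y = 1 := by
  rw [← map_mul, h, map_one]

lemma inv_mul_eq_of_mul_eq_mul {M : Type} [Monoid M] {t tinv u l m minv r rinv : M}
    (h : t * u = l * m * r) (ht : tinv * t = 1) (hm : m * minv = 1) (hr : r * rinv = 1) :
    tinv * l = u * rinv * minv := by
  calc tinv * l = tinv * (l * (m * (r * rinv) * minv)) := by rw [hr, mul_one, hm, mul_one]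
    _ = tinv * (l * m * r) * (rinv * minv) := by simp only [mul_assoc]
    _ = tinv * t * (u * (rinv * minv)) := by rw [← h]; simp only [mul_assoc]
    _ = _ := by rw [ht, one_mul, mul_assoc]

lemma pentagon_PhiInv : q.comulThird q.PhiInv * padLeft q.Phi =
    q.comulFirst (H ⊗[k] H) q.Phi * padRight q.PhiInv * q.comulMid q.PhiInv :=
  inv_mul_eq_of_mul_eq_mul q.pentagon_Phi
    (map_mul_eq_one_of_mul_eq_one q.comulThird q.PhiInv_mul_Phi)
    (map_mul_eq_one_of_mul_eq_one q.comulMid q.Phi_mul_PhiInv)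
    (map_mul_eq_one_of_mul_eq_one (padRight (k := k) (H := H)) q.Phi_mul_PhiInv)

lemma counit_comul_right (x : H) :
    TensorProduct.rid k H (TensorProduct.map LinearMap.id q.counit.toLinearMap (q.comul x)) = x := by
  conv_rhs => rw [← q.counit_right x]
  simp [q.comul_eq x]

/-- `x ⊗ y ⊗ b ↦ ε(y) x ⊗ b` -/
def counitSecond (B : Type) [Ring B] [Algebra k B] : H ⊗[k] (H ⊗[k] B) →ₐ[k] H ⊗[k] B :=
  Algebra.TensorProduct.map (AlgHom.id k H) (q.counitFirst B)

@[simp] lemma counitSecond_tmul (x : H) (y : H ⊗[k] B) :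
    q.counitSecond B (x ⊗ₜ y) = x ⊗ₜ q.counitFirst B y := rfl

lemma counitSecond_Phi : q.counitSecond H q.Phi = 1 := by
  rw [Algebra.TensorProduct.one_def, ← q.counit_mid_phi]
  simp [Phi]

lemma counitSecond_comulThird (x : H ⊗[k] (H ⊗[k] H)) :
    q.counitSecond (H ⊗[k] H) (q.comulThird x) = q.comulLast (q.counitSecond H x) := by
  induction x with
  | zero => simp
  | add x₁ x₂ h₁ h₂ => simp only [map_add, h₁, h₂]
  | tmul a y =>
    induction y with
    | zero => simp
    | add x₁ x₂ h₁ h₂ => simp only [map_add, TensorProduct.tmul_add, h₁, h₂]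
    | tmul b c => simp

lemma counitSecond_padRight (x : H ⊗[k] (H ⊗[k] H)) :
    q.counitSecond (H ⊗[k] H) (padRight x) =
      Algebra.TensorProduct.map (AlgHom.id k H) Algebra.TensorProduct.includeLeft
        (q.counitSecond H x) := by
  induction x with
  | zero => simp
  | add x₁ x₂ h₁ h₂ => simp only [map_add, h₁, h₂]
  | tmul a y =>
    induction y with
    | zero => simp
    | add x₁ x₂ h₁ h₂ => simp only [map_add, TensorProduct.tmul_add, h₁, h₂]
    | tmul b c =>
      simp only [padRight_tmul, counitSecond_tmul, counitFirst_tmul, TensorProduct.tmul_smul,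
        map_smul, Algebra.TensorProduct.map_tmul, AlgHom.coe_id, id_eq,
        Algebra.TensorProduct.includeLeft_apply]

lemma counitSecond_comulFirst (x : H ⊗[k] B) :
    q.counitSecond B (q.comulFirst B x) = x := by
  induction x with
  | zero => simp
  | add x₁ x₂ h₁ h₂ => simp only [map_add, h₁, h₂]
  | tmul a b =>
    conv_rhs => rw [← q.counit_right a]
    simp [q.comul_eq a, TensorProduct.sum_tmul, TensorProduct.smul_tmul']

lemma counitFirst_comulFirst (x : H ⊗[k] B) :
    q.counitFirst _ (q.comulFirst B x) = x := by
  induction x with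
  | zero => simp
  | add x₁ x₂ h₁ h₂ => simp only [map_add, h₁, h₂]
  | tmul a b =>
    conv_rhs => rw [← q.counit_left a]
    simp [q.comul_eq a, TensorProduct.sum_tmul, TensorProduct.smul_tmul']

lemma counitSecond_comulMid (x : H ⊗[k] (H ⊗[k] H)) :
    q.counitSecond (H ⊗[k] H) (q.comulMid x) = x := by
  induction x with
  | zero => simp
  | add x₁ x₂ h₁ h₂ => simp only [map_add, h₁, h₂]
  | tmul a y => simp [counitFirst_comulFirst]

lemma counitFirst_Phi : q.counitFirst (H ⊗[k] H) q.Phi = 1 := by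
  have h := congrArg (q.counitSecond (H ⊗[k] H)) q.pentagon_Phi
  simp only [map_mul, counitSecond_comulThird, counitSecond_comulFirst, counitSecond_comulMid,
    counitSecond_padRight, counitSecond_Phi, map_one, one_mul, mul_one, padLeft_apply,
    counitSecond_tmul] at h
  have hInv := congrArg (fun x => q.counitFirst (H ⊗[k] H) (x * q.PhiInv)) h
  simpa [mul_assoc, q.Phi_mul_PhiInv] using hInv.symm

lemma contractAlpha_comulFirst_mul (x : H ⊗[k] B) (y : H ⊗[k] (H ⊗[k] B)) :
    q.contractAlpha B (q.comulFirst B x * y) =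
      (1 ⊗ₜ q.counitFirst B x) * q.contractAlpha B y := by
  induction x with
  | zero => simp
  | add x₁ x₂ h₁ h₂ => simp only [map_add, add_mul, TensorProduct.tmul_add, h₁, h₂]
  | tmul a b =>
    induction y with
    | zero => simp
    | add x₁ x₂ h₁ h₂ => simp only [map_add, mul_add, h₁, h₂]
    | tmul c y =>
      induction y with
      | zero => simp
      | add x₁ x₂ h₁ h₂ => simp only [map_add, mul_add, TensorProduct.tmul_add, h₁, h₂]
      | tmul d e =>
        have key : ∑ i ∈ Finset.range (q.n a),
            q.S (q.d1 a i * c) * q.alpha * (q.d2 a i * d) =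
            q.counit a • (q.S c * q.alpha * d) := by
          rw [← smul_mul_assoc, ← mul_smul_comm, ← q.antipode_alpha a]
          simp only [Finset.mul_sum, Finset.sum_mul, q.S_mul, mul_assoc]
        simp only [comulFirst_tmul, q.comul_eq a, TensorProduct.sum_tmul, map_sum,
          Finset.sum_mul, TensorProduct.assoc_tmul, Algebra.TensorProduct.tmul_mul_tmul,
          contractAlpha_tmul, counitFirst_tmul]
        rw [← TensorProduct.sum_tmul, key, one_mul, smul_mul_assoc, TensorProduct.smul_tmul]

lemma contractAlpha_mul_tmul (y : H ⊗[k] (H ⊗[k] B)) (a : H) (z : H ⊗[k] B) :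
    q.contractAlpha B (y * (a ⊗ₜ z)) = (q.S a ⊗ₜ 1) * q.contractAlpha B y * z := by
  induction z with
  | zero => simp
  | add x₁ x₂ h₁ h₂ => simp only [map_add, mul_add, TensorProduct.tmul_add, h₁, h₂]
  | tmul b c =>
    induction y with
    | zero => simp
    | add x₁ x₂ h₁ h₂ => simp only [map_add, mul_add, add_mul, h₁, h₂]
    | tmul d y =>
      induction y with
      | zero => simp
      | add x₁ x₂ h₁ h₂ =>
        simp only [map_add, mul_add, add_mul, TensorProduct.tmul_add, h₁, h₂]
      | tmul e f => simp [q.S_mul, mul_assoc]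

lemma contractAlpha_PhiInv : q.contractAlpha H q.PhiInv = q.qLE := by
  simp [PhiInv, qLE, qL1, qL2]

lemma contractAlpha_comulThird (x : H ⊗[k] (H ⊗[k] H)) :
    q.contractAlpha (H ⊗[k] H) (q.comulThird x) = q.comulLast (q.contractAlpha H x) := by
  induction x with
  | zero => simp
  | add x₁ x₂ h₁ h₂ => simp only [map_add, h₁, h₂]
  | tmul a y =>
    induction y with
    | zero => simp
    | add x₁ x₂ h₁ h₂ => simp only [map_add, TensorProduct.tmul_add, h₁, h₂]
    | tmul b c => simp

lemma contractAlpha_padRight (x : H ⊗[k] (H ⊗[k] H)) :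
    q.contractAlpha (H ⊗[k] H) (padRight x) =
      Algebra.TensorProduct.map (AlgHom.id k H) Algebra.TensorProduct.includeLeft
        (q.contractAlpha H x) := by
  induction x with
  | zero => simp
  | add x₁ x₂ h₁ h₂ => simp only [map_add, h₁, h₂]
  | tmul a y =>
    induction y with
    | zero => simp
    | add x₁ x₂ h₁ h₂ => simp only [map_add, TensorProduct.tmul_add, h₁, h₂]
    | tmul b c => simp

/-- `S(h₍₁₎) q^L_1 h₍₂₎₍₁₎ ⊗ q^L_2 h₍₂₎₍₂₎ = q^L_1 ⊗ h q^L_2` -/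
lemma qLE_conj (h : H) :
    ∑ i ∈ Finset.range (q.n h), (q.S (q.d1 h i) ⊗ₜ 1) * q.qLE * q.comul (q.d2 h i) =
      (1 ⊗ₜ h) * q.qLE := by
  have h1 := congrArg (q.contractAlpha H) (q.PhiInv_mul_comulLast_comul h)
  rw [contractAlpha_comulFirst_mul, contractAlpha_PhiInv] at h1
  have h2 : q.counitFirst H (q.comul h) = h := by
    conv_rhs => rw [← q.counit_left h]
    simp [q.comul_eq h]
  rw [h2] at h1
  rw [← h1]
  simp only [q.comul_eq h, map_sum, Finset.mul_sum, comulLast_tmul, contractAlpha_mul_tmul,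
    contractAlpha_PhiInv]

/-- `q^L_1 φ1 ⊗ q^L_2₍₁₎ φ2 ⊗ q^L_2₍₂₎ φ3 = S(φ̄1) q^L_1 φ̄2₍₁₎ ⊗ q^L_2 φ̄2₍₂₎ ⊗ φ̄3` -/
lemma comulLast_qLE_mul_Phi : q.comulLast q.qLE * q.Phi =
    ∑ b ∈ Finset.range q.nq, (q.S (q.Q1 b) ⊗ₜ 1) *
      Algebra.TensorProduct.map (AlgHom.id k H) Algebra.TensorProduct.includeLeft q.qLE *
      q.comulFirst H (q.Q2 b ⊗ₜ q.Q3 b) := by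
  have h := congrArg (q.contractAlpha (H ⊗[k] H)) q.pentagon_PhiInv
  rw [padLeft_apply, contractAlpha_mul_tmul, contractAlpha_comulThird, contractAlpha_PhiInv,
    q.S_one, ← Algebra.TensorProduct.one_def, one_mul, mul_assoc, contractAlpha_comulFirst_mul,
    counitFirst_Phi, ← Algebra.TensorProduct.one_def, one_mul] at h
  rw [h]
  conv_lhs => enter [2, 2]; rw [PhiInv]
  simp only [map_sum, Finset.mul_sum, comulMid_tmul, contractAlpha_mul_tmul,
    contractAlpha_padRight, contractAlpha_PhiInv]

lemma twistInv_eq : q.twistInv = q.twistInvMap q.qLE := by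
  simp [twistInv, qLE, sswap_comul]

lemma bEl_eq :
    q.bEl = q.contractBeta (q.comulFirst (H ⊗[k] H) q.Phi * padRight q.PhiInv) := by
  simp only [bEl, Phi, PhiInv, map_sum, comulFirst_tmul, padRight_tmul, q.comul_eq (q.P1 _),
    TensorProduct.sum_tmul, TensorProduct.assoc_tmul, Finset.sum_mul, Finset.mul_sum,
    Algebra.TensorProduct.tmul_mul_tmul, contractBeta_tmul, mul_one]
  rw [Finset.sum_comm]

lemma contractBeta_assoc_mul (u w : H ⊗[k] H) (z : H ⊗[k] (H ⊗[k] (H ⊗[k] H))) :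
    q.contractBeta (TensorProduct.assoc k H H (H ⊗[k] H) (u ⊗ₜ w) * z) =
      u * q.contractBeta z * q.sswap w := by
  induction u with
  | zero => simp
  | add x₁ x₂ h₁ h₂ => simp only [TensorProduct.add_tmul, map_add, add_mul, h₁, h₂]
  | tmul u₁ u₂ =>
  induction w with
  | zero => simp
  | add x₁ x₂ h₁ h₂ => simp only [TensorProduct.tmul_add, map_add, add_mul, mul_add, h₁, h₂]
  | tmul w₁ w₂ =>
  induction z with
  | zero => simp
  | add x₁ x₂ h₁ h₂ => simp only [map_add, add_mul, mul_add, h₁, h₂]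
  | tmul a z =>
  induction z with
  | zero => simp
  | add x₁ x₂ h₁ h₂ => simp only [TensorProduct.tmul_add, map_add, add_mul, mul_add, h₁, h₂]
  | tmul b z =>
  induction z with
  | zero => simp
  | add x₁ x₂ h₁ h₂ => simp only [TensorProduct.tmul_add, map_add, add_mul, mul_add, h₁, h₂]
  | tmul c d => simp [q.S_mul, mul_assoc]

lemma twistInvMap_eq (w : H ⊗[k] H) :
    q.twistInvMap w = q.contractBeta (q.comulFirst (H ⊗[k] H) (q.comulLast w * q.Phi) *
      padRight q.PhiInv) := by
  induction w with
  | zero => simp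
  | add x₁ x₂ h₁ h₂ => simp only [map_add, add_mul, h₁, h₂]
  | tmul x y =>
    rw [twistInvMap_tmul, bEl_eq, ← contractBeta_assoc_mul, ← comulFirst_tmul, ← comulLast_tmul,
      ← mul_assoc, ← map_mul (q.comulFirst (H ⊗[k] H))]

lemma contractBeta_tmul_mul (a b c d y : H) (u : H ⊗[k] H) :
    q.contractBeta ((a ⊗ₜ (b ⊗ₜ (c ⊗ₜ d))) *
        (padRight (q.comulLast u) * (1 ⊗ₜ (1 ⊗ₜ (1 ⊗ₜ y))))) =
      (a * (TensorProduct.rid k H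
        (TensorProduct.map LinearMap.id q.counit.toLinearMap u)) * q.beta * q.S (d * y)) ⊗ₜ
        (b * q.beta * q.S c) := by
  induction u with
  | zero => simp
  | add x₁ x₂ h₁ h₂ =>
    simp only [map_add, add_mul, mul_add, TensorProduct.add_tmul, h₁, h₂]
  | tmul u₁ u₂ =>
    have key : ∑ i ∈ Finset.range (q.n u₂), b * q.d1 u₂ i * q.beta * q.S (c * q.d2 u₂ i) =
        q.counit u₂ • (b * q.beta * q.S c) := by
      rw [← smul_mul_assoc, ← mul_smul_comm, ← q.antipode_beta u₂]
      simp only [Finset.mul_sum, Finset.sum_mul, q.S_mul, mul_assoc]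
    simp only [comulLast_tmul, q.comul_eq u₂, TensorProduct.tmul_sum, map_sum, padRight_tmul,
      Finset.sum_mul, Finset.mul_sum, Algebra.TensorProduct.tmul_mul_tmul, contractBeta_tmul,
      mul_one, one_mul]
    rw [← TensorProduct.tmul_sum, key]
    simp [TensorProduct.smul_tmul']

lemma contractBeta_mul_padRight (z : H ⊗[k] (H ⊗[k] (H ⊗[k] H))) (h : H) :
    ∑ i ∈ Finset.range (q.n h), q.contractBeta (z *
        (padRight (q.comulLast (q.comul (q.d1 h i))) * (1 ⊗ₜ (1 ⊗ₜ (1 ⊗ₜ q.d2 h i))))) =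
      q.counit h • q.contractBeta z := by
  induction z with
  | zero => simp
  | add x₁ x₂ h₁ h₂ => simp only [map_add, add_mul, smul_add, Finset.sum_add_distrib, h₁, h₂]
  | tmul a z =>
  induction z with
  | zero => simp
  | add x₁ x₂ h₁ h₂ =>
    simp only [TensorProduct.tmul_add, map_add, add_mul, smul_add, Finset.sum_add_distrib, h₁, h₂]
  | tmul b z =>
  induction z with
  | zero => simp
  | add x₁ x₂ h₁ h₂ =>
    simp only [TensorProduct.tmul_add, map_add, add_mul, smul_add, Finset.sum_add_distrib, h₁, h₂]
  | tmul c d =>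
    have key : ∑ i ∈ Finset.range (q.n h), a * q.d1 h i * q.beta * q.S (d * q.d2 h i) =
        q.counit h • (a * q.beta * q.S d) := by
      rw [← smul_mul_assoc, ← mul_smul_comm, ← q.antipode_beta h]
      simp only [Finset.mul_sum, Finset.sum_mul, q.S_mul, mul_assoc]
    simp only [contractBeta_tmul_mul, counit_comul_right]
    rw [← TensorProduct.sum_tmul, key, contractBeta_tmul, TensorProduct.smul_tmul']

lemma comulFirst_comulFirst_tmul (x y : H) :
    q.comulFirst (H ⊗[k] H) (q.comulFirst H (x ⊗ₜ y)) =
      padRight (q.comulFirst H (q.comul x)) * (1 ⊗ₜ (1 ⊗ₜ (1 ⊗ₜ y))) := by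
  rw [comulFirst_tmul]
  generalize q.comul x = u
  induction u with
  | zero => simp
  | add x₁ x₂ h₁ h₂ => simp only [map_add, add_mul, TensorProduct.add_tmul, h₁, h₂]
  | tmul u₁ u₂ =>
    simp only [TensorProduct.assoc_tmul, comulFirst_tmul]
    generalize q.comul u₁ = v
    induction v with
    | zero => simp
    | add x₁ x₂ h₁ h₂ => simp only [map_add, add_mul, TensorProduct.add_tmul, h₁, h₂]
    | tmul v₁ v₂ => simp

lemma padRight_mul_comm (z : H ⊗[k] (H ⊗[k] H)) (y : H) :
    (1 ⊗ₜ (1 ⊗ₜ (1 ⊗ₜ y))) * padRight z = padRight (k := k) z * (1 ⊗ₜ (1 ⊗ₜ (1 ⊗ₜ y))) := by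
  induction z with
  | zero => simp
  | add x₁ x₂ h₁ h₂ => simp only [map_add, add_mul, mul_add, h₁, h₂]
  | tmul a z =>
  induction z with
  | zero => simp
  | add x₁ x₂ h₁ h₂ => simp only [TensorProduct.tmul_add, map_add, add_mul, mul_add, h₁, h₂]
  | tmul b c => simp

/-- `Δ(h₍₁₎) · 𝕓 · (S ⊗ S)(Δ^cop h₍₂₎) = ε(h) 𝕓` -/
lemma twistInvMap_comul (h : H) : q.twistInvMap (q.comul h) = q.counit h • q.bEl := by
  rw [twistInvMap_eq, comulLast_comul_mul_Phi, map_mul (q.comulFirst (H ⊗[k] H)), mul_assoc,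
    bEl_eq, ← contractBeta_mul_padRight]
  conv_lhs => rw [q.comul_eq h]
  simp only [map_sum, Finset.sum_mul, Finset.mul_sum]
  refine Finset.sum_congr rfl fun i _ => ?_
  rw [comulFirst_comulFirst_tmul, mul_assoc, padRight_mul_comm, ← mul_assoc (padRight _),
    ← map_mul, ← PhiInv_mul_comulLast_comul, map_mul (padRight (k := k) (H := H)),
    mul_assoc, mul_assoc]

lemma twistInvMap_mul_comul (z : H ⊗[k] H) (h : H) :
    q.twistInvMap (z * q.comul h) = q.counit h • q.twistInvMap z := by
  induction z with
  | zero => simp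
  | add x₁ x₂ h₁ h₂ => simp only [map_add, add_mul, smul_add, h₁, h₂]
  | tmul x y =>
    have key : ∀ w : H ⊗[k] H, q.twistInvMap ((x ⊗ₜ y) * w) =
        q.comul x * q.twistInvMap w * q.sswap (q.comul y) := by
      intro w
      induction w with
      | zero => simp
      | add x₁ x₂ h₁ h₂ => simp only [map_add, add_mul, mul_add, h₁, h₂]
      | tmul c d => simp [sswap_mul, mul_assoc]
    rw [key, twistInvMap_comul]
    simp

lemma twistInvMap_tmul_one_mul (a : H) (z : H ⊗[k] H) :
    q.twistInvMap ((a ⊗ₜ 1) * z) = q.comul a * q.twistInvMap z := by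
  induction z with
  | zero => simp
  | add x₁ x₂ h₁ h₂ => simp only [map_add, mul_add, h₁, h₂]
  | tmul x y => simp [mul_assoc]

lemma twistInvMap_one_tmul_mul (a : H) (z : H ⊗[k] H) :
    q.twistInvMap ((1 ⊗ₜ a) * z) = q.twistInvMap z * q.sswap (q.comul a) := by
  induction z with
  | zero => simp
  | add x₁ x₂ h₁ h₂ => simp only [map_add, mul_add, add_mul, h₁, h₂]
  | tmul x y => simp [sswap_mul, mul_assoc]

/-- `Δ(S h) f⁻¹ = f⁻¹ (S ⊗ S)(Δ^cop h)` -/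
lemma comul_S_mul_twistInv (h : H) :
    q.comul (q.S h) * q.twistInv = q.twistInv * q.sswap (q.comul h) := by
  rw [twistInv_eq, ← twistInvMap_one_tmul_mul, ← qLE_conj]
  simp only [map_sum, twistInvMap_mul_comul, twistInvMap_tmul_one_mul]
  conv_lhs => rw [← q.counit_right h]
  simp only [map_sum, map_smul, Finset.sum_mul, smul_mul_assoc]

lemma sswapInv_comul_mul_twistInv (x : H) :
    q.sswapInv (q.comul x * q.twistInv) = q.comul (q.Sinv x) * q.sswapInv q.twistInv := by
  conv_lhs => rw [← q.S_Sinv x, comul_S_mul_twistInv, sswapInv_mul, sswapInv_sswap]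

/-- `x ⊗ y ⊗ z ↦ μ(z) x ⊗ y` -/
def evalLast (mu : H →ₐ[k] k) : H ⊗[k] (H ⊗[k] H) →ₐ[k] H ⊗[k] H :=
  Algebra.TensorProduct.map (AlgHom.id k H) ((Algebra.TensorProduct.rid k k H).toAlgHom.comp
    (Algebra.TensorProduct.map (AlgHom.id k H) mu))

@[simp] lemma evalLast_tmul (mu : H →ₐ[k] k) (x y z : H) :
    evalLast mu (x ⊗ₜ (y ⊗ₜ z)) = x ⊗ₜ[k] (mu z • y) := rfl

lemma evalLast_comulLast (mu : H →ₐ[k] k) (x : H ⊗[k] H) :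
    evalLast mu (q.comulLast x) = TensorProduct.map LinearMap.id (q.rhook mu) x := by
  induction x with
  | zero => simp
  | add x₁ x₂ h₁ h₂ => simp only [map_add, h₁, h₂]
  | tmul a b => rfl

lemma evalLast_includeLeft (mu : H →ₐ[k] k) (x : H ⊗[k] H) :
    evalLast mu (Algebra.TensorProduct.map (AlgHom.id k H)
      Algebra.TensorProduct.includeLeft x) = x := by
  induction x with
  | zero => simp
  | add x₁ x₂ h₁ h₂ => simp only [map_add, h₁, h₂]
  | tmul a b => simp

lemma evalLast_comulFirst_tmul (mu : H →ₐ[k] k) (x y : H) :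
    evalLast mu (q.comulFirst H (x ⊗ₜ y)) = mu y • q.comul x := by
  rw [comulFirst_tmul]
  generalize q.comul x = u
  induction u with
  | zero => simp
  | add x₁ x₂ h₁ h₂ => simp only [map_add, TensorProduct.add_tmul, smul_add, h₁, h₂]
  | tmul a b => simp

/-- `W^R = μ(φ̄3) Δ(S̄(φ̄2)) U^R (1 ⊗ φ̄1)` -/
lemma WR_eq (mu : H →ₐ[k] k) : q.WR mu =
    ∑ b ∈ Finset.range q.nq,
      mu (q.Q3 b) • (q.comul (q.Sinv (q.Q2 b)) * q.UR * (1 ⊗ₜ q.Q1 b)) := by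
  have hPhi : ∑ a ∈ Finset.range q.np, mu (q.P3 a) • (q.P1 a ⊗ₜ[k] q.P2 a) =
      evalLast mu q.Phi := by
    simp [Phi]
  rw [WR, hPhi, ← evalLast_comulLast, ← map_mul, comulLast_qLE_mul_Phi]
  simp only [map_sum, Finset.sum_mul, map_mul, evalLast_includeLeft, evalLast_comulFirst_tmul,
    mul_smul_comm, smul_mul_assoc, map_smul]
  refine Finset.sum_congr rfl fun b _ => ?_
  have h1 : evalLast mu (q.S (q.Q1 b) ⊗ₜ 1) = q.S (q.Q1 b) ⊗ₜ[k] 1 := by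
    rw [Algebra.TensorProduct.one_def, evalLast_tmul, map_one, one_smul]
  rw [h1, mul_assoc, sswapInv_mul, sswapInv_comul_mul_twistInv, sswapInv_mul, UR, sswapInv_mul,
    sswapInv_tmul, q.Sinv_S, q.Sinv_one]
  simp only [mul_assoc]

lemma hitL_mul_one_tmul (lam : H →ₗ[k] k) (z : H ⊗[k] H) (a : H) :
    hitL lam (z * (1 ⊗ₜ a)) = hitL lam z * a := by
  induction z with
  | zero => simp
  | add x₁ x₂ h₁ h₂ => simp only [map_add, add_mul, h₁, h₂]
  | tmul x y => simp [hitL]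

/-- `x ⊗ y ⊗ z ↦ μ(z) E(h S̄(y)) x` -/
def cointegralPairing (mu : H →ₐ[k] k) (E : H →ₗ[k] H) (h : H) :
    H ⊗[k] (H ⊗[k] H) →ₗ[k] H :=
  TensorProduct.lift ((LinearMap.mul k H).comp
    (E.comp ((LinearMap.mulLeft k h).comp q.Sinv))).flip ∘ₗ (evalLast mu).toLinearMap

@[simp] lemma cointegralPairing_tmul (mu : H →ₐ[k] k) (E : H →ₗ[k] H) (h x y z : H) :
    q.cointegralPairing mu E h (x ⊗ₜ (y ⊗ₜ z)) = mu z • (E (h * q.Sinv y) * x) := by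
  simp [cointegralPairing]

lemma cointegralPairing_one (mu : H →ₐ[k] k) (E : H →ₗ[k] H) (h : H) :
    q.cointegralPairing mu E h 1 = E h := by
  simp [Algebra.TensorProduct.one_def, q.Sinv_one]

lemma cointegralPairing_mul_tmul (mu : H →ₐ[k] k) (E : H →ₗ[k] H) (h x y z : H)
    (w : H ⊗[k] (H ⊗[k] H)) :
    q.cointegralPairing mu E h (w * (x ⊗ₜ (y ⊗ₜ z))) =
      mu z • (q.cointegralPairing mu E (h * q.Sinv y) w * x) := by
  induction w with
  | zero => simp
  | add x₁ x₂ h₁ h₂ => simp only [map_add, add_mul, smul_add, h₁, h₂]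
  | tmul a w =>
    induction w with
    | zero => simp
    | add x₁ x₂ h₁ h₂ =>
      simp only [TensorProduct.tmul_add, map_add, add_mul, smul_add, h₁, h₂]
    | tmul b c => simp [q.Sinv_mul, mul_assoc, smul_smul, mul_comm (mu c)]

lemma hitL_WR (mu : H →ₐ[k] k) (lam : H →ₗ[k] k) (h : H) :
    hitL lam (q.VR * q.comul h * q.WR mu) = ∑ b ∈ Finset.range q.nq,
      mu (q.Q3 b) • (hitL lam (q.VR * q.comul (h * q.Sinv (q.Q2 b)) * q.UR) * q.Q1 b) := by
  simp only [WR_eq, Finset.mul_sum, mul_smul_comm, map_sum, map_smul, ← mul_assoc,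
    hitL_mul_one_tmul, map_mul]

end Helpers

end QuasiHopf

/-- For `λ ∈ H*` the right-cointegral condition
`⟨λ, V^R_1 h₍₁₎ U^R_1⟩ V^R_2 h₍₂₎ U^R_2 = φ1 ⟨λ, h S̄(φ2)⟩ μ(φ3)` is equivalent to
`⟨λ, V^R_1 h₍₁₎ W^R_1⟩ V^R_2 h₍₂₎ W^R_2 = λ(h) 1`. -/
theorem statement10 (k H : Type) [Field k] [Ring H] [Algebra k H] (q : QuasiHopf k H)
    (mu : H →ₐ[k] k) (lam : H →ₗ[k] k) :
    (∀ h : H, hitL lam (q.VR * q.comul h * q.UR) =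
        ∑ a ∈ Finset.range q.np, (lam (h * q.Sinv (q.P2 a)) * mu (q.P3 a)) • q.P1 a) ↔
    (∀ h : H, hitL lam (q.VR * q.comul h * q.WR mu) = lam h • (1 : H)) := by
  set E : H →ₗ[k] H := hitL lam ∘ₗ LinearMap.mulRight k q.UR ∘ₗ LinearMap.mulLeft k q.VR ∘ₗ
    q.comul.toLinearMap
  have hE_apply (h : H) : hitL lam (q.VR * q.comul h * q.UR) = E h := rfl
  have hW (h : H) : hitL lam (q.VR * q.comul h * q.WR mu) =
      q.cointegralPairing mu E h q.PhiInv := by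
    simp only [q.hitL_WR, QuasiHopf.PhiInv, hE_apply, map_sum, q.cointegralPairing_tmul]
  have hP (h : H) : ∑ a ∈ Finset.range q.np, (lam (h * q.Sinv (q.P2 a)) * mu (q.P3 a)) • q.P1 a =
      q.cointegralPairing mu (lam.smulRight 1) h q.Phi := by
    simp [QuasiHopf.Phi, smul_smul, mul_comm]
  simp only [hW, hP, hE_apply]
  constructor
  · intro hi h
    have key : q.cointegralPairing mu E h q.PhiInv =
        q.cointegralPairing mu (lam.smulRight 1) h (q.Phi * q.PhiInv) := by
      simp only [QuasiHopf.PhiInv, Finset.mul_sum, map_sum, q.cointegralPairing_mul_tmul, ← hi,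
        q.cointegralPairing_tmul]
    rw [key, q.Phi_mul_PhiInv, q.cointegralPairing_one, LinearMap.smulRight_apply]
  · intro hii h
    rw [← q.cointegralPairing_one mu E h, ← q.PhiInv_mul_Phi]
    simp only [QuasiHopf.Phi, Finset.mul_sum, map_sum, q.cointegralPairing_mul_tmul, hii,
      q.cointegralPairing_tmul, LinearMap.smulRight_apply]
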